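/- The similarity between two forests equals the maximum weight of a valid mapping between them: sim(F1, F2) = max over mappings {(u_t, v_t)} of Σ_t η(u_t, v_t), where η(u,v) = 2 if u and v have equal labels and 1 otherwise, and a mapping is a set of node pairs (u_t ∈ F1, v_t ∈ F2), with all u_t distinct and all v_t distinct, preserving the ancestor relation and the left-to-right (precedes) relation in both directions. -/

import Mathlib

/-- Ordered rooted trees with node labels from `α`. -/
inductive Tree' (α : Type) : Type
  | node (label : α) (children : List (Tree' α))

/-- An ordered forest is an ordered list of trees. -/
abbrev Forest (α : Type) := List (Tree' α)

mutual
/-- Number of nodes of a tree. -/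
def Tree'.size {α : Type} : Tree' α → ℕ
  | .node _ cs => 1 + Forest.size cs
/-- Number of nodes of a forest. -/
def Forest.size {α : Type} : Forest α → ℕ
  | [] => 0
  | t :: ts => Tree'.size t + Forest.size ts
end

/-- A single edit operation on a forest: delete a node (promoting its children, in
order, to its parent) or relabel a node. -/
inductive EditStep {α : Type} : Forest α → Forest α → Prop
  | delete (pre : Forest α) (a : α) (cs post : Forest α) :
      EditStep (pre ++ Tree'.node a cs :: post) (pre ++ cs ++ post)
  | relabel (pre : Forest α) (a b : α) (cs post : Forest α) :
      EditStep (pre ++ Tree'.node a cs :: post) (pre ++ Tree'.node b cs :: post)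
  | inside (pre : Forest α) (a : α) {cs cs' : Forest α} (post : Forest α) :
      EditStep cs cs' →
      EditStep (pre ++ Tree'.node a cs :: post) (pre ++ Tree'.node a cs' :: post)

/-- `EditSteps n F G`: `G` is obtained from `F` by exactly `n` edit operations. -/
inductive EditSteps {α : Type} : ℕ → Forest α → Forest α → Prop
  | refl (F : Forest α) : EditSteps 0 F F
  | tail {n : ℕ} {F G H : Forest α} : EditSteps n F G → EditStep G H → EditSteps (n + 1) F H

/-- The (unweighted) tree edit distance: the minimum total number of relabelings
and deletions applied to `F1` and `F2` so that they become identical. -/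
noncomputable def ed {α : Type} (F1 F2 : Forest α) : ℕ :=
  sInf {k | ∃ (k1 k2 : ℕ) (G : Forest α), k = k1 + k2 ∧ EditSteps k1 F1 G ∧ EditSteps k2 F2 G}

/-- The similarity between two forests. -/
noncomputable def sim {α : Type} (F1 F2 : Forest α) : ℤ :=
  (Forest.size F1 : ℤ) + Forest.size F2 - ed F1 F2

mutual
/-- Helper for the subforest operation: the part of tree `t`, whose bi-order
traversal interval starts at position `p`, surviving the restriction to positions `[l, r)`.
A node is kept iff both of its occurrences lie at positions `l, …, r - 1`;
removed nodes have their children promoted. -/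
def cutT {α : Type} (l r p : ℕ) : Tree' α → Forest α
  | .node a cs =>
      if l ≤ p ∧ p + 2 * Tree'.size (Tree'.node a cs) ≤ r then [Tree'.node a cs]
      else cutF l r (p + 1) cs
/-- The part of forest `F`, whose bi-order traversal starts at position `p`,
surviving the restriction to positions `[l, r)`. -/
def cutF {α : Type} (l r p : ℕ) : Forest α → Forest α
  | [] => []
  | t :: ts => cutT l r p t ++ cutF l r (p + 2 * Tree'.size t) ts
end

/-- The subforest `F[l, r)` determined by the interval `[l, r)` of the (1-indexed)
bi-order traversal sequence of `F`. -/
def subforest {α : Type} (F : Forest α) (l r : ℕ) : Forest α := cutF l r 1 F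

/-- `OccF F base p t`: the forest `F`, whose bi-order traversal starts at position `base`,
has a node with subtree `t` whose first occurrence is at position `p`. -/
inductive OccF {α : Type} : Forest α → ℕ → ℕ → Tree' α → Prop
  | head (a : α) (cs ts : Forest α) (base : ℕ) :
      OccF (Tree'.node a cs :: ts) base base (Tree'.node a cs)
  | inChildren {cs : Forest α} {p : ℕ} {t : Tree' α} (a : α) (ts : Forest α) (base : ℕ) :
      OccF cs (base + 1) p t → OccF (Tree'.node a cs :: ts) base p t
  | inRest {ts : Forest α} {p : ℕ} {t : Tree' α} (t0 : Tree' α) (base : ℕ) :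
      OccF ts (base + 2 * Tree'.size t0) p t → OccF (t0 :: ts) base p t

/-- The label of the root of a tree. -/
def Tree'.label {α : Type} : Tree' α → α
  | .node a _ => a

/-- A node occurrence `(p, t)` (first occurrence at position `p`, subtree `t`) is a strict
ancestor of the occurrence `(q, s)`. -/
def Anc {α : Type} (u v : ℕ × Tree' α) : Prop :=
  u.1 < v.1 ∧ v.1 + 2 * Tree'.size v.2 ≤ u.1 + 2 * Tree'.size u.2

/-- The node occurrence `u` precedes the node occurrence `v`: `r(u) ≤ l(v)`. -/
def Prec {α : Type} (u v : ℕ × Tree' α) : Prop :=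
  u.1 + 2 * Tree'.size u.2 ≤ v.1

section ForestBasics

variable {α : Type}

theorem Tree'.size_pos (t : Tree' α) : 0 < t.size := by
  cases t; simp only [Tree'.size]; omega

theorem Forest.size_append (A B : Forest α) :
    Forest.size (A ++ B) = Forest.size A + Forest.size B := by
  induction A with
  | nil => simp [Forest.size]
  | cons t ts ih => simp only [List.cons_append, Forest.size, ih]; omega

/-- Induction on forests through the children and the right siblings of the first root. -/
theorem Forest.induction_on {motive : Forest α → Prop} (F : Forest α) (nil : motive [])
    (cons : ∀ a cs ts, motive cs → motive ts → motive (Tree'.node a cs :: ts)) : motive F := by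
  induction h : Forest.size F using Nat.strong_induction_on generalizing F with
  | _ n ih =>
    match F with
    | [] => exact nil
    | Tree'.node a cs :: ts =>
      simp only [Forest.size, Tree'.size] at h
      exact cons a cs ts (ih _ (by omega) cs rfl) (ih _ (by omega) ts rfl)

theorem EditStep.cons {F G : Forest α} (t : Tree' α) (h : EditStep F G) :
    EditStep (t :: F) (t :: G) := by
  cases h with
  | delete pre a cs post => exact .delete (t :: pre) a cs post
  | relabel pre a b cs post => exact .relabel (t :: pre) a b cs post
  | inside pre a post h => exact .inside (t :: pre) a post h

namespace EditSteps

theorem trans {m n : ℕ} {F G H : Forest α} (h₁ : EditSteps m F G) (h₂ : EditSteps n G H) :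
    EditSteps (m + n) F H := by
  induction h₂ with
  | refl => exact h₁
  | tail _ h ih => exact .tail (ih h₁) h

theorem single {F G : Forest α} (h : EditStep F G) : EditSteps 1 F G := .tail (.refl F) h

theorem head {n : ℕ} {F G H : Forest α} (h₁ : EditStep F G) (h₂ : EditSteps n G H) :
    EditSteps (n + 1) F H := by
  rw [add_comm]; exact (single h₁).trans h₂

theorem cons {n : ℕ} {F G : Forest α} (t : Tree' α) (h : EditSteps n F G) :
    EditSteps n (t :: F) (t :: G) := by
  induction h with
  | refl => exact .refl _
  | tail _ h ih => exact .tail ih (h.cons t)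

theorem inside {n : ℕ} {cs cs' : Forest α} (a : α) (ts : Forest α) (h : EditSteps n cs cs') :
    EditSteps n (Tree'.node a cs :: ts) (Tree'.node a cs' :: ts) := by
  induction h with
  | refl => exact .refl _
  | tail _ h ih => exact .tail ih (.inside [] a ts h)

end EditSteps

/-- `Layout lab L F`: the occurrences listed in `L` are placed relative to each other like the
nodes of `F` in preorder, and `lab` assigns to them the labels of these nodes. -/
inductive Layout (lab : ℕ × Tree' α → α) : List (ℕ × Tree' α) → Forest α → Prop
  | nil : Layout lab [] []
  | cons {x : ℕ × Tree' α} {A B : List (ℕ × Tree' α)} {cs ts : Forest α} :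
      Layout lab A cs → Layout lab B ts → (∀ y ∈ A, Anc x y) → (∀ y ∈ B, Prec x y) →
      (∀ y ∈ A, ∀ z ∈ B, Prec y z) → Layout lab (x :: (A ++ B)) (Tree'.node (lab x) cs :: ts)

theorem Prec.ne {u v : ℕ × Tree' α} (h : Prec u v) : u ≠ v := by
  rintro rfl
  have := u.2.size_pos
  simp only [Prec] at h
  omega

theorem Anc.ne {u v : ℕ × Tree' α} (h : Anc u v) : u ≠ v := by
  rintro rfl
  exact lt_irrefl _ h.1

namespace Layout

variable {lab : ℕ × Tree' α → α}

theorem congr {lab' : ℕ × Tree' α → α} {L : List (ℕ × Tree' α)} {F : Forest α}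
    (h : Layout lab L F) (hl : ∀ y ∈ L, lab' y = lab y) : Layout lab' L F := by
  induction h with
  | nil => exact .nil
  | @cons x A B cs ts _ _ hA hB hAB ihA ihB =>
    rw [← hl x (by simp)]
    exact .cons (ihA fun y hy => hl y (by simp [hy])) (ihB fun y hy => hl y (by simp [hy]))
      hA hB hAB

theorem append {L₁ L₂ : List (ℕ × Tree' α)} {F G : Forest α} (h₁ : Layout lab L₁ F)
    (h₂ : Layout lab L₂ G) (h : ∀ x ∈ L₁, ∀ y ∈ L₂, Prec x y) :
    Layout lab (L₁ ++ L₂) (F ++ G) := by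
  induction h₁ with
  | nil => exact h₂
  | @cons x A B cs ts hcs hts hA hB hAB ihA ihB =>
    simp only [List.cons_append, List.append_assoc]
    refine .cons hcs (ihB fun u hu v hv => h u (by simp [hu]) v hv) hA ?_ ?_
    · intro y hy
      rcases List.mem_append.1 hy with hy | hy
      · exact hB y hy
      · exact h x (by simp) y hy
    · intro y hy z hz
      rcases List.mem_append.1 hz with hz | hz
      · exact hAB y hy z hz
      · exact h y (by simp [hy]) z hz

theorem exists_of_append {F G : Forest α} : ∀ {L : List (ℕ × Tree' α)}, Layout lab L (F ++ G) →
    ∃ L₁ L₂, L = L₁ ++ L₂ ∧ Layout lab L₁ F ∧ Layout lab L₂ G ∧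
      ∀ x ∈ L₁, ∀ y ∈ L₂, Prec x y := by
  induction F with
  | nil => exact fun {L} h => ⟨[], L, rfl, .nil, h, by simp⟩
  | cons t F ih =>
    intro L h
    cases h with
    | @cons x A B cs ts hcs hts hA hB hAB =>
      obtain ⟨C, D, rfl, hC, hD, hCD⟩ := ih hts
      refine ⟨x :: (A ++ C), D, by simp, .cons hcs hC hA (fun y hy => hB y (by simp [hy]))
        (fun y hy z hz => hAB y hy z (by simp [hz])), hD, ?_⟩
      intro u hu v hv
      simp only [List.mem_cons, List.mem_append] at hu
      rcases hu with rfl | hu | hu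
      · exact hB v (by simp [hv])
      · exact hAB u hu v (by simp [hv])
      · exact hCD u hu v hv

theorem editStep {F F' : Forest α} (h : EditStep F F') : ∀ {lab : ℕ × Tree' α → α}
    {L : List (ℕ × Tree' α)}, Layout lab L F →
    (∃ L', L' ⊆ L ∧ Layout lab L' F' ∧ Forest.size F = Forest.size F' + 1) ∨
    (∃ lab' x, x ∈ L ∧ (∀ y, y ≠ x → lab' y = lab y) ∧ Layout lab' L F' ∧
      Forest.size F = Forest.size F') := by
  classical
  induction h with
  | delete pre a cs post =>
    intro lab L h
    obtain ⟨P, Q, rfl, hP, hQ, hPQ⟩ := h.exists_of_append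
    cases hQ with
    | @cons x A B _ _ hA hB hxA hxB hAB =>
      refine .inl ⟨P ++ A ++ B, by intro y; simp; tauto, ?_, ?_⟩
      · refine (hP.append hA fun u hu v hv => hPQ u hu v (by simp [hv])).append hB ?_
        intro u hu v hv
        rcases List.mem_append.1 hu with hu | hu
        · exact hPQ u hu v (by simp [hv])
        · exact hAB u hu v hv
      · simp only [Forest.size_append, Forest.size, Tree'.size]; omega
  | relabel pre a b cs post =>
    intro lab L h
    obtain ⟨P, Q, rfl, hP, hQ, hPQ⟩ := h.exists_of_append
    cases hQ with
    | @cons x A B _ _ hA hB hxA hxB hAB =>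
      have key : ∀ y, y ≠ x → Function.update lab x b y = lab y := fun y hy => by simp [hy]
      refine .inr ⟨Function.update lab x b, x, by simp, key, ?_, ?_⟩
      · have hQ' := Layout.cons (hA.congr fun y hy => key y (hxA y hy).ne.symm)
          (hB.congr fun y hy => key y (hxB y hy).ne.symm) hxA hxB hAB
        rw [Function.update_self] at hQ'
        exact (hP.congr fun y hy => key y (hPQ y hy x (by simp)).ne).append hQ' hPQ
      · simp only [Forest.size_append, Forest.size, Tree'.size]
  | inside pre a post _ ih =>
    intro lab L h
    obtain ⟨P, Q, rfl, hP, hQ, hPQ⟩ := h.exists_of_append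
    cases hQ with
    | @cons x A B _ _ hA hB hxA hxB hAB =>
      rcases ih hA with ⟨A', hsub, hA', hsize⟩ | ⟨lab', z, hz, key, hA', hsize⟩
      · refine .inl ⟨P ++ x :: (A' ++ B), ?_, ?_, ?_⟩
        · intro y hy
          have := @hsub y
          simp only [List.mem_append, List.mem_cons] at hy ⊢
          tauto
        · refine hP.append (.cons hA' hB (fun y hy => hxA y (hsub hy)) hxB
            fun y hy => hAB y (hsub hy)) ?_
          intro u hu v hv
          have := @hsub v
          refine hPQ u hu v ?_
          simp only [List.mem_append, List.mem_cons] at hv ⊢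
          tauto
        · simp only [Forest.size_append, Forest.size, Tree'.size]; omega
      · refine .inr ⟨lab', z, by simp [hz], key, ?_, ?_⟩
        · rw [← key x (hxA z hz).ne]
          exact (hP.congr fun y hy => key y (hPQ y hy z (by simp [hz])).ne).append
            (.cons hA' (hB.congr fun y hy => key y (hAB z hz y hy).ne.symm) hxA hxB hAB) hPQ
        · simp only [Forest.size_append, Forest.size, Tree'.size]; omega

end Layout

theorem OccF.bounds {F : Forest α} {base p : ℕ} {t : Tree' α} (h : OccF F base p t) :
    base ≤ p ∧ p + 2 * t.size ≤ base + 2 * Forest.size F := by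
  induction h with
  | head => simp only [Forest.size]; omega
  | inChildren => simp only [Forest.size, Tree'.size] at *; omega
  | inRest => simp only [Forest.size] at *; omega

/-- The occurrences of a forest form a layout of it. -/
theorem exists_layout (F : Forest α) : ∀ base, ∃ L : List (ℕ × Tree' α),
    Layout (fun x => x.2.label) L F ∧ ∀ x, x ∈ L ↔ OccF F base x.1 x.2 := by
  induction F using Forest.induction_on with
  | nil => exact fun base => ⟨[], .nil, fun x => ⟨by simp, fun h => by cases h⟩⟩
  | cons a cs ts ihcs ihts =>
    intro base
    obtain ⟨A, hA, memA⟩ := ihcs (base + 1)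
    obtain ⟨B, hB, memB⟩ := ihts (base + 2 * (Tree'.node a cs).size)
    refine ⟨(base, Tree'.node a cs) :: (A ++ B), .cons hA hB ?_ ?_ ?_, ?_⟩
    · intro y hy
      have := ((memA y).1 hy).bounds
      simp only [Anc, Tree'.size]
      omega
    · intro y hy
      exact ((memB y).1 hy).bounds.1
    · intro y hy z hz
      have := ((memA y).1 hy).bounds
      have := ((memB z).1 hz).bounds
      simp only [Prec, Tree'.size] at *
      omega
    · rintro ⟨p, t⟩
      simp only [List.mem_cons, List.mem_append, memA, memB, Prod.mk.injEq]
      constructor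
      · rintro (⟨rfl, rfl⟩ | h | h)
        · exact .head ..
        · exact .inChildren _ _ _ h
        · exact .inRest _ _ h
      · intro h
        cases h with
        | head => simp
        | inChildren _ _ _ h => simp [h]
        | inRest _ _ h => simp [h]

/-- Two pairs of occurrences may occur together in a mapping. -/
def Compatible (p q : (ℕ × Tree' α) × (ℕ × Tree' α)) : Prop :=
  p.1.1 ≠ q.1.1 ∧ p.2.1 ≠ q.2.1 ∧ (Anc p.1 q.1 ↔ Anc p.2 q.2) ∧ (Prec p.1 q.1 ↔ Prec p.2 q.2)

/-- A mapping between two lists of occurrences. -/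
structure IsMapping (L₁ L₂ : List (ℕ × Tree' α))
    (M : Finset ((ℕ × Tree' α) × (ℕ × Tree' α))) : Prop where
  left : ∀ p ∈ M, p.1 ∈ L₁
  right : ∀ p ∈ M, p.2 ∈ L₂
  compatible : ∀ p ∈ M, ∀ q ∈ M, p ≠ q → Compatible p q

theorem Compatible.of_anc {p q : (ℕ × Tree' α) × (ℕ × Tree' α)} (h₁ : Anc p.1 q.1)
    (h₂ : Anc p.2 q.2) : Compatible p q ∧ Compatible q p := by
  have := p.1.2.size_pos
  have := p.2.2.size_pos
  have := q.1.2.size_pos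
  have := q.2.2.size_pos
  simp only [Compatible, Anc, Prec] at *
  omega

theorem Compatible.of_prec {p q : (ℕ × Tree' α) × (ℕ × Tree' α)} (h₁ : Prec p.1 q.1)
    (h₂ : Prec p.2 q.2) : Compatible p q ∧ Compatible q p := by
  have := p.1.2.size_pos
  have := p.2.2.size_pos
  have := q.1.2.size_pos
  have := q.2.2.size_pos
  simp only [Compatible, Anc, Prec] at *
  omega

theorem IsMapping.swap {L₁ L₂ : List (ℕ × Tree' α)}
    {M : Finset ((ℕ × Tree' α) × (ℕ × Tree' α))} (h : IsMapping L₁ L₂ M) :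
    IsMapping L₂ L₁ (M.map (Equiv.prodComm _ _).toEmbedding) := by
  refine ⟨?_, ?_, ?_⟩
  · simp only [Finset.mem_map_equiv]
    exact fun p hp => h.right _ hp
  · simp only [Finset.mem_map_equiv]
    exact fun p hp => h.left _ hp
  · simp only [Finset.mem_map_equiv]
    intro p hp q hq hpq
    obtain ⟨h₁, h₂, h₃, h₄⟩ := h.compatible _ hp _ hq (by simpa using hpq)
    exact ⟨h₂, h₁, h₃.symm, h₄.symm⟩

variable [DecidableEq α]

/-- The weight of a pair of occurrences: `2` if the labels agree and `1` otherwise. -/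
def pairWeight (lab₁ lab₂ : ℕ × Tree' α → α) (p : (ℕ × Tree' α) × (ℕ × Tree' α)) : ℤ :=
  if lab₁ p.1 = lab₂ p.2 then 2 else 1

/-- A mapping yields edit scripts of total length complementary to its weight. -/
theorem IsMapping.exists_editSteps {lab₁ lab₂ : ℕ × Tree' α → α} {F₁ F₂ : Forest α}
    {L₁ L₂ : List (ℕ × Tree' α)} {M : Finset ((ℕ × Tree' α) × (ℕ × Tree' α))}
    (h₁ : Layout lab₁ L₁ F₁) (h₂ : Layout lab₂ L₂ F₂) (hM : IsMapping L₁ L₂ M) :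
    ∃ (k₁ k₂ : ℕ) (G : Forest α), EditSteps k₁ F₁ G ∧ EditSteps k₂ F₂ G ∧
      (k₁ : ℤ) + k₂ + ∑ p ∈ M, pairWeight lab₁ lab₂ p ≤ Forest.size F₁ + Forest.size F₂ := by
  classical
  induction hn : Forest.size F₁ + Forest.size F₂ using Nat.strong_induction_on
    generalizing F₁ F₂ L₁ L₂ M with
  | _ n ih =>
  have left_unmatched : ∀ {x A B cs ts}, L₁ = x :: (A ++ B) →
      F₁ = Tree'.node (lab₁ x) cs :: ts → Layout lab₁ (A ++ B) (cs ++ ts) →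
      (∀ p ∈ M, p.1 ≠ x) → ∃ (k₁ k₂ : ℕ) (G : Forest α), EditSteps k₁ F₁ G ∧ EditSteps k₂ F₂ G ∧
      (k₁ : ℤ) + k₂ + ∑ p ∈ M, pairWeight lab₁ lab₂ p ≤ Forest.size F₁ + Forest.size F₂ := by
    rintro x A B cs ts rfl rfl hAB hx
    have hsize : Forest.size (Tree'.node (lab₁ x) cs :: ts) = Forest.size (cs ++ ts) + 1 := by
      simp only [Forest.size_append, Forest.size, Tree'.size]; omega
    obtain ⟨k₁, k₂, G, e₁, e₂, hk⟩ := ih _ (by omega) hAB h₂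
      ⟨fun p hp => (List.mem_cons.1 (hM.left p hp)).resolve_left (hx p hp), hM.right,
        hM.compatible⟩ rfl
    exact ⟨k₁ + 1, k₂, G, .head (.delete [] _ cs ts) e₁, e₂, by rw [hsize]; push_cast; omega⟩
  have right_unmatched : ∀ {y A B cs ts}, L₂ = y :: (A ++ B) →
      F₂ = Tree'.node (lab₂ y) cs :: ts → Layout lab₂ (A ++ B) (cs ++ ts) →
      (∀ p ∈ M, p.2 ≠ y) → ∃ (k₁ k₂ : ℕ) (G : Forest α), EditSteps k₁ F₁ G ∧ EditSteps k₂ F₂ G ∧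
      (k₁ : ℤ) + k₂ + ∑ p ∈ M, pairWeight lab₁ lab₂ p ≤ Forest.size F₁ + Forest.size F₂ := by
    rintro y A B cs ts rfl rfl hAB hy
    have hsize : Forest.size (Tree'.node (lab₂ y) cs :: ts) = Forest.size (cs ++ ts) + 1 := by
      simp only [Forest.size_append, Forest.size, Tree'.size]; omega
    obtain ⟨k₁, k₂, G, e₁, e₂, hk⟩ := ih _ (by omega) h₁ hAB
      ⟨hM.left, fun p hp => (List.mem_cons.1 (hM.right p hp)).resolve_left (hy p hp),
        hM.compatible⟩ rfl
    exact ⟨k₁, k₂ + 1, G, e₁, .head (.delete [] _ cs ts) e₂, by rw [hsize]; push_cast; omega⟩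
  cases h₁ with
  | nil =>
    have hM0 : M = ∅ := Finset.eq_empty_of_forall_notMem fun p hp => by simpa using hM.left p hp
    cases h₂ with
    | nil => exact ⟨0, 0, [], .refl _, .refl _, by simp [hM0]⟩
    | @cons y A B cs ts hA hB _ _ hAB =>
      exact right_unmatched rfl rfl (hA.append hB hAB) (by simp [hM0])
  | @cons x A₁ B₁ cs₁ ts₁ hA₁ hB₁ hxA₁ hxB₁ hAB₁ =>
  by_cases hx : ∀ p ∈ M, p.1 ≠ x
  · exact left_unmatched rfl rfl (hA₁.append hB₁ hAB₁) hx
  push Not at hx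
  obtain ⟨p, hp, rfl⟩ := hx
  cases h₂ with
  | nil => simpa using hM.right p hp
  | @cons y A₂ B₂ cs₂ ts₂ hA₂ hB₂ hxA₂ hxB₂ hAB₂ =>
  by_cases hy : ∀ p ∈ M, p.2 ≠ y
  · exact right_unmatched rfl rfl (hA₂.append hB₂ hAB₂) hy
  push Not at hy
  obtain ⟨q, hq, rfl⟩ := hy
  have hleft : ∀ r ∈ M, r.1 = p.1 ∨ (r.1 ∈ A₁ ∧ Anc p.1 r.1) ∨ (r.1 ∈ B₁ ∧ Prec p.1 r.1) := by
    intro r hr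
    have := hM.left r hr
    simp only [List.mem_cons, List.mem_append] at this
    rcases this with h | h | h
    · exact .inl h
    · exact .inr (.inl ⟨h, hxA₁ _ h⟩)
    · exact .inr (.inr ⟨h, hxB₁ _ h⟩)
  have hright : ∀ r ∈ M, r.2 = q.2 ∨ (r.2 ∈ A₂ ∧ Anc q.2 r.2) ∨ (r.2 ∈ B₂ ∧ Prec q.2 r.2) := by
    intro r hr
    have := hM.right r hr
    simp only [List.mem_cons, List.mem_append] at this
    rcases this with h | h | h
    · exact .inl h
    · exact .inr (.inl ⟨h, hxA₂ _ h⟩)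
    · exact .inr (.inr ⟨h, hxB₂ _ h⟩)
  have excl : ∀ u v : ℕ × Tree' α, Anc u v → ¬ Prec u v := by
    intro u v
    have := v.2.size_pos
    simp only [Anc, Prec]
    omega
  have asymm : ∀ u v : ℕ × Tree' α, (Anc u v ∨ Prec u v) → ¬ (Anc v u ∨ Prec v u) := by
    intro u v
    have := v.2.size_pos
    have := u.2.size_pos
    simp only [Anc, Prec]
    omega
  have hpq : p = q := by
    by_contra hne
    obtain ⟨c₁, c₂, c₃, c₄⟩ := hM.compatible q hq p hp (Ne.symm hne)
    have h1 : Anc q.2 p.2 ∨ Prec q.2 p.2 := by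
      rcases hright p hp with h | h | h
      · exact absurd (congrArg Prod.fst h.symm) c₂
      · exact .inl h.2
      · exact .inr h.2
    have h2 : Anc p.1 q.1 ∨ Prec p.1 q.1 := by
      rcases hleft q hq with h | h | h
      · exact absurd (congrArg Prod.fst h) c₁
      · exact .inl h.2
      · exact .inr h.2
    exact asymm _ _ h2 (h1.imp c₃.2 c₄.2)
  subst hpq
  set N := M.erase p with hN
  have hNM : ∀ r ∈ N, r ∈ M := fun r hr => Finset.mem_of_mem_erase hr
  have hcomp : ∀ r ∈ N, Compatible p r := fun r hr =>
    hM.compatible p hp r (hNM r hr) (Finset.ne_of_mem_erase hr).symm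
  have hleft' : ∀ r ∈ N, (r.1 ∈ A₁ ∧ Anc p.1 r.1) ∨ (r.1 ∈ B₁ ∧ Prec p.1 r.1) := fun r hr =>
    (hleft r (hNM r hr)).resolve_left fun h => (hcomp r hr).1 (congrArg Prod.fst h.symm)
  have hright' : ∀ r ∈ N, (r.2 ∈ A₂ ∧ Anc p.2 r.2) ∨ (r.2 ∈ B₂ ∧ Prec p.2 r.2) := fun r hr =>
    (hright r (hNM r hr)).resolve_left fun h => (hcomp r hr).2.1 (congrArg Prod.fst h.symm)
  have inner : IsMapping A₁ A₂ (N.filter fun r => Anc p.1 r.1) := by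
    refine ⟨fun r hr => ?_, fun r hr => ?_, fun r hr s hs =>
      hM.compatible r (hNM r (Finset.mem_filter.1 hr).1) s (hNM s (Finset.mem_filter.1 hs).1)⟩
    · obtain ⟨hr, ha⟩ := Finset.mem_filter.1 hr
      exact ((hleft' r hr).resolve_right fun h => excl _ _ ha h.2).1
    · obtain ⟨hr, ha⟩ := Finset.mem_filter.1 hr
      exact ((hright' r hr).resolve_right fun h => excl _ _ ((hcomp r hr).2.2.1.1 ha) h.2).1
  have outer : IsMapping B₁ B₂ (N.filter fun r => ¬ Anc p.1 r.1) := by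
    refine ⟨fun r hr => ?_, fun r hr => ?_, fun r hr s hs =>
      hM.compatible r (hNM r (Finset.mem_filter.1 hr).1) s (hNM s (Finset.mem_filter.1 hs).1)⟩
    · obtain ⟨hr, ha⟩ := Finset.mem_filter.1 hr
      exact ((hleft' r hr).resolve_left fun h => ha h.2).1
    · obtain ⟨hr, ha⟩ := Finset.mem_filter.1 hr
      exact ((hright' r hr).resolve_left fun h => ha ((hcomp r hr).2.2.1.2 h.2)).1
  have hsum : ∑ r ∈ M, pairWeight lab₁ lab₂ r = pairWeight lab₁ lab₂ p +
      (∑ r ∈ N with Anc p.1 r.1, pairWeight lab₁ lab₂ r +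
        ∑ r ∈ N with ¬ Anc p.1 r.1, pairWeight lab₁ lab₂ r) := by
    rw [Finset.sum_filter_add_sum_filter_not, Finset.add_sum_erase _ _ hp]
  simp only [Forest.size, Tree'.size] at hn
  obtain ⟨i₁, i₂, G, ei₁, ei₂, hi⟩ := ih _ (by omega) hA₁ hA₂ inner rfl
  obtain ⟨j₁, j₂, H, ej₁, ej₂, hj⟩ := ih _ (by omega) hB₁ hB₂ outer rfl
  have e₁ := (ei₁.inside (lab₁ p.1) ts₁).trans (ej₁.cons (Tree'.node (lab₁ p.1) G))
  have e₂ := (ei₂.inside (lab₂ p.2) ts₂).trans (ej₂.cons (Tree'.node (lab₂ p.2) G))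
  by_cases hl : lab₁ p.1 = lab₂ p.2
  · refine ⟨_, i₂ + j₂, _, e₁, by rw [hl]; exact e₂, ?_⟩
    rw [hsum, pairWeight, if_pos hl]
    simp only [Forest.size, Tree'.size]
    push_cast
    omega
  · refine ⟨_, _, _, e₁.tail (.relabel [] _ (lab₂ p.2) G H), e₂, ?_⟩
    rw [hsum, pairWeight, if_neg hl]
    simp only [Forest.size, Tree'.size]
    push_cast
    omega

/-- Every layout of `F₁` and every layout of `F₂` admit a mapping of weight at least
`|F₁| + |F₂| - c`. -/
def HasMapping (F₁ F₂ : Forest α) (c : ℕ) : Prop :=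
  ∀ (lab₁ lab₂ : ℕ × Tree' α → α) (L₁ L₂ : List (ℕ × Tree' α)), Layout lab₁ L₁ F₁ →
    Layout lab₂ L₂ F₂ → ∃ M, IsMapping L₁ L₂ M ∧
      (Forest.size F₁ : ℤ) + Forest.size F₂ ≤ ∑ p ∈ M, pairWeight lab₁ lab₂ p + c

namespace HasMapping

theorem refl (F : Forest α) : HasMapping F F 0 := by
  classical
  intro lab₁ lab₂
  induction F using Forest.induction_on with
  | nil =>
    intro L₁ L₂ _ _
    exact ⟨∅, ⟨by simp, by simp, by simp⟩, by simp [Forest.size]⟩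
  | cons a cs ts ihcs ihts =>
    intro L₁ L₂ h₁ h₂
    generalize hF : Tree'.node a cs :: ts = F' at h₂
    cases h₁ with
    | @cons x A₁ B₁ _ _ hA₁ hB₁ hxA₁ hxB₁ hAB₁ =>
    cases h₂ with
    | nil => cases hF
    | @cons y A₂ B₂ cs' ts' hA₂ hB₂ hyA₂ hyB₂ hAB₂ =>
    simp only [List.cons.injEq, Tree'.node.injEq] at hF
    obtain ⟨⟨hl, rfl⟩, rfl⟩ := hF
    obtain ⟨M, hM, hMs⟩ := ihcs A₁ A₂ hA₁ hA₂
    obtain ⟨N, hN, hNs⟩ := ihts B₁ B₂ hB₁ hB₂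
    have hdisj : Disjoint M N := Finset.disjoint_left.2 fun p hp hq =>
      (hAB₁ _ (hM.left p hp) _ (hN.left p hq)).ne rfl
    have hxy : (x, y) ∉ M ∪ N := by
      intro h
      rcases Finset.mem_union.1 h with h | h
      · exact (hxA₁ _ (hM.left _ h)).ne rfl
      · exact (hxB₁ _ (hN.left _ h)).ne rfl
    have cM : ∀ p ∈ M, Compatible (x, y) p ∧ Compatible p (x, y) := fun p hp =>
      Compatible.of_anc (hxA₁ _ (hM.left p hp)) (hyA₂ _ (hM.right p hp))
    have cN : ∀ p ∈ N, Compatible (x, y) p ∧ Compatible p (x, y) := fun p hp =>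
      Compatible.of_prec (hxB₁ _ (hN.left p hp)) (hyB₂ _ (hN.right p hp))
    have cMN : ∀ p ∈ M, ∀ q ∈ N, Compatible p q ∧ Compatible q p := fun p hp q hq =>
      Compatible.of_prec (hAB₁ _ (hM.left p hp) _ (hN.left q hq))
        (hAB₂ _ (hM.right p hp) _ (hN.right q hq))
    refine ⟨insert (x, y) (M ∪ N), ⟨?_, ?_, ?_⟩, ?_⟩
    · intro p hp
      simp only [Finset.mem_insert, Finset.mem_union] at hp
      rcases hp with rfl | hp | hp
      · simp
      · simp [hM.left p hp]
      · simp [hN.left p hp]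
    · intro p hp
      simp only [Finset.mem_insert, Finset.mem_union] at hp
      rcases hp with rfl | hp | hp
      · simp
      · simp [hM.right p hp]
      · simp [hN.right p hp]
    · intro p hp q hq hpq
      simp only [Finset.mem_insert, Finset.mem_union] at hp hq
      rcases hp with rfl | hp | hp <;> rcases hq with rfl | hq | hq
      · exact absurd rfl hpq
      · exact (cM q hq).1
      · exact (cN q hq).1
      · exact (cM p hp).2
      · exact hM.compatible p hp q hq hpq
      · exact (cMN p hp q hq).1
      · exact (cN p hp).2
      · exact (cMN q hq p hp).2
      · exact hN.compatible p hp q hq hpq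
    · rw [Finset.sum_insert hxy, Finset.sum_union hdisj, pairWeight, if_pos hl]
      simp only [Forest.size, Tree'.size]
      push_cast at *
      omega

theorem symm {F₁ F₂ : Forest α} {c : ℕ} (h : HasMapping F₁ F₂ c) : HasMapping F₂ F₁ c := by
  intro lab₁ lab₂ L₁ L₂ h₁ h₂
  obtain ⟨M, hM, hs⟩ := h lab₂ lab₁ L₂ L₁ h₂ h₁
  refine ⟨_, hM.swap, ?_⟩
  have hswap : ∀ p, pairWeight lab₁ lab₂ p.swap = pairWeight lab₂ lab₁ p := fun p => by
    simp only [pairWeight, Prod.fst_swap, Prod.snd_swap, eq_comm]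
  simp only [Finset.sum_map, Equiv.coe_toEmbedding, Equiv.prodComm_apply, hswap]
  omega

theorem of_editStep {F F' F₂ : Forest α} {c : ℕ} (h : EditStep F F') (hm : HasMapping F' F₂ c) :
    HasMapping F F₂ (c + 1) := by
  classical
  intro lab₁ lab₂ L₁ L₂ h₁ h₂
  rcases Layout.editStep h h₁ with ⟨L', hsub, hL', hsize⟩ | ⟨lab', x, -, key, hL', hsize⟩
  · obtain ⟨M, hM, hs⟩ := hm lab₁ lab₂ L' L₂ hL' h₂
    refine ⟨M, ⟨fun p hp => hsub (hM.left p hp), hM.right, hM.compatible⟩, ?_⟩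
    rw [hsize]
    push_cast
    omega
  · obtain ⟨M, hM, hs⟩ := hm lab' lab₂ L₁ L₂ hL' h₂
    refine ⟨M, hM, ?_⟩
    have hle : ∑ p ∈ M, pairWeight lab' lab₂ p ≤
        ∑ p ∈ M, (pairWeight lab₁ lab₂ p + if p.1 = x then 1 else 0) := by
      refine Finset.sum_le_sum fun p _ => ?_
      by_cases hp : p.1 = x
      · simp only [pairWeight, hp, if_true]
        split_ifs <;> norm_num
      · simp [pairWeight, hp, key p.1 hp]
    have hone : ∑ p ∈ M, (if p.1 = x then (1 : ℤ) else 0) ≤ 1 := by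
      rw [Finset.sum_boole]
      have : (M.filter fun p => p.1 = x).card ≤ 1 := by
        refine Finset.card_le_one.2 fun p hp q hq => ?_
        obtain ⟨hp, hpx⟩ := Finset.mem_filter.1 hp
        obtain ⟨hq, hqx⟩ := Finset.mem_filter.1 hq
        by_contra hne
        exact (hM.compatible p hp q hq hne).1 (by rw [hpx, hqx])
      exact_mod_cast this
    rw [Finset.sum_add_distrib] at hle
    rw [hsize]
    push_cast
    omega

theorem of_editSteps {n : ℕ} {F F' F₂ : Forest α} (h : EditSteps n F F') :
    ∀ {c : ℕ}, HasMapping F' F₂ c → HasMapping F F₂ (c + n) := by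
  induction h with
  | refl => exact id
  | @tail n _ _ _ _ h ih =>
    intro c hm
    have := ih (of_editStep h hm)
    rwa [add_assoc, add_comm 1 n] at this

end HasMapping

end ForestBasics

/-- The similarity between two forests equals the maximum weight of a valid mapping:
a sequence of pairs of node occurrences, with all first components distinct, all second
components distinct, preserving the ancestor relation and the precedes relation in both
directions; a pair of nodes with equal labels weighs 2 and otherwise 1. -/
theorem sim_eq_max_mapping_weight {α : Type} [DecidableEq α] (F1 F2 : Forest α) :
    IsGreatest {w : ℤ | ∃ (k : ℕ) (m : Fin k → (ℕ × Tree' α) × (ℕ × Tree' α)),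
      (∀ i, OccF F1 1 (m i).1.1 (m i).1.2) ∧
      (∀ i, OccF F2 1 (m i).2.1 (m i).2.2) ∧
      (∀ i j, i ≠ j → (m i).1.1 ≠ (m j).1.1) ∧
      (∀ i j, i ≠ j → (m i).2.1 ≠ (m j).2.1) ∧
      (∀ i j, i ≠ j → (Anc (m i).1 (m j).1 ↔ Anc (m i).2 (m j).2)) ∧
      (∀ i j, i ≠ j → (Prec (m i).1 (m j).1 ↔ Prec (m i).2 (m j).2)) ∧
      w = ∑ i, (if Tree'.label (m i).1.2 = Tree'.label (m i).2.2 then (2 : ℤ) else 1)}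
      (sim F1 F2) := by
  classical
  obtain ⟨L₁, hL₁, mem₁⟩ := exists_layout F1 1
  obtain ⟨L₂, hL₂, mem₂⟩ := exists_layout F2 1
  have upper : ∀ M, IsMapping L₁ L₂ M →
      ∑ p ∈ M, pairWeight (fun x => x.2.label) (fun x => x.2.label) p ≤ sim F1 F2 := by
    intro M hM
    obtain ⟨k₁, k₂, G, e₁, e₂, hk⟩ := hM.exists_editSteps hL₁ hL₂
    have hed : ed F1 F2 ≤ k₁ + k₂ := Nat.sInf_le ⟨k₁, k₂, G, rfl, e₁, e₂⟩
    rw [sim]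
    omega
  refine ⟨?_, ?_⟩
  · have hne : {k | ∃ (k1 k2 : ℕ) (G : Forest α),
        k = k1 + k2 ∧ EditSteps k1 F1 G ∧ EditSteps k2 F2 G}.Nonempty := by
      obtain ⟨k₁, k₂, G, e₁, e₂, -⟩ := IsMapping.exists_editSteps (M := ∅) hL₁ hL₂
        ⟨by simp, by simp, by simp⟩
      exact ⟨_, k₁, k₂, G, rfl, e₁, e₂⟩
    obtain ⟨k₁, k₂, G, hk, e₁, e₂⟩ := Nat.sInf_mem hne
    obtain ⟨M, hM, hs⟩ := HasMapping.of_editSteps e₁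
      (HasMapping.of_editSteps e₂ (HasMapping.refl G)).symm _ _ L₁ L₂ hL₁ hL₂
    have hsim : sim F1 F2 = ∑ p ∈ M, pairWeight (fun x => x.2.label) (fun x => x.2.label) p := by
      refine le_antisymm ?_ (upper M hM)
      rw [sim, ed, hk]
      push_cast at hs ⊢
      omega
    have hcomp : ∀ i j : Fin M.card, i ≠ j →
        Compatible (M.equivFin.symm i).1 (M.equivFin.symm j).1 := fun i j hij =>
      hM.compatible _ (M.equivFin.symm i).2 _ (M.equivFin.symm j).2 fun h =>
        hij (M.equivFin.symm.injective (Subtype.ext h))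
    refine ⟨M.card, fun i => (M.equivFin.symm i).1,
      fun i => (mem₁ _).1 (hM.left _ (M.equivFin.symm i).2),
      fun i => (mem₂ _).1 (hM.right _ (M.equivFin.symm i).2),
      fun i j hij => (hcomp i j hij).1, fun i j hij => (hcomp i j hij).2.1,
      fun i j hij => (hcomp i j hij).2.2.1, fun i j hij => (hcomp i j hij).2.2.2, ?_⟩
    rw [hsim, ← Finset.sum_coe_sort]
    exact (Equiv.sum_comp M.equivFin.symm _).symm
  · rintro w ⟨k, m, occ₁, occ₂, ne₁, ne₂, anc, prec, rfl⟩
    have hinj : Function.Injective m := fun i j hij => by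
      by_contra hne
      exact ne₁ i j hne (by rw [hij])
    have hM : IsMapping L₁ L₂ (Finset.univ.image m) := by
      constructor <;>
        simp only [Finset.mem_image, Finset.mem_univ, true_and, forall_exists_index,
          forall_apply_eq_imp_iff]
      · exact fun i => (mem₁ _).2 (occ₁ i)
      · exact fun i => (mem₂ _).2 (occ₂ i)
      · intro i j hij
        have hne : i ≠ j := fun h => hij (by rw [h])
        exact ⟨ne₁ i j hne, ne₂ i j hne, anc i j hne, prec i j hne⟩
    have := upper _ hM
    rwa [Finset.sum_image fun i _ j _ h => hinj h] at this
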